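/- Let X be a finite alphabet, Ψ = {S_j : X* → ℝ^p | j ∈ J} a family of formal power series, and N > 0. Suppose the span of the columns of the full Hankel matrix H_Ψ is finite-dimensional with dimension equal to rank H_{Ψ,N,N} = r (this holds in particular whenever Ψ admits a rational representation of dimension ≤ N+1). Let O, R be matrices with H_{Ψ,N+1,N} = O·R, rank O = rank R = r, where O has rows indexed by (v,i), |v| ≤ N+1, i ∈ {1,…,p}, and columns {1,…,r}, and R has rows {1,…,r} and columns indexed by (w,j), |w| ≤ N, j ∈ J. Define C̃, B̃_j, Γ̄, Γ̄_σ and Ã_σ as in the factorization construction (C̃ from the rows of O indexed by (ε,i), B̃_j the column of R indexed by (ε,j), Ã_σ the unique solution of Γ̄ Ã_σ = Γ̄_σ). Then R̃_N = (ℝ^r, {Ã_σ}_{σ∈X}, {B̃_j}_{j∈J}, C̃) is a representation of Ψ, i.e., S_j(w) = C̃ Ã_w B̃_j for all j ∈ J and ALL words w ∈ X*, and R̃_N is a minimal representation of Ψ. -/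

import Mathlib

open Matrix

section PowerSeriesDefs

variable {X J : Type*} {p n : ℕ}

/-- `A_w = A_{σ_k} ⋯ A_{σ_1}` for the word `w = σ_1 ⋯ σ_k`. -/
def wordProd {n : ℕ} (A : X → Matrix (Fin n) (Fin n) ℝ) : List X → Matrix (Fin n) (Fin n) ℝ
  | [] => 1
  | σ :: w => wordProd A w * A σ

/-- Column of the full Hankel matrix of the family `S`, indexed by `(w, j)`. -/
def hankelCol (S : J → List X → Fin p → ℝ) (w : List X) (j : J) : List X × Fin p → ℝ :=
  fun vi => S j (w ++ vi.1) vi.2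

/-- Linear span of the columns of the full Hankel matrix `H_Ψ`. -/
def fullHankelSpan (S : J → List X → Fin p → ℝ) : Submodule ℝ (List X × Fin p → ℝ) :=
  Submodule.span ℝ (Set.range fun wj : List X × J => hankelCol S wj.1 wj.2)

/-- Column of the sub-Hankel matrix `H_{Ψ,M,K}` (rows restricted to `|v| ≤ M`). -/
def hankelColTrunc (S : J → List X → Fin p → ℝ) (M : ℕ) (w : List X) (j : J) :
    {v : List X // v.length ≤ M} × Fin p → ℝ :=
  fun vi => S j (w ++ vi.1.1) vi.2

/-- `rank H_{Ψ,M,K}` : dimension of the span of the columns of the sub-Hankel matrix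
whose rows are indexed by `(v,i)` with `|v| ≤ M` and whose columns are indexed by
`(w,j)` with `|w| ≤ K`. -/
noncomputable def hankelRank (S : J → List X → Fin p → ℝ) (M K : ℕ) : ℕ :=
  Module.finrank ℝ (Submodule.span ℝ
    (Set.range fun wj : {w : List X // w.length ≤ K} × J =>
      hankelColTrunc S M wj.1.1 wj.2))

/-- `R = (ℝⁿ, {A_σ}, B, C)` is an `N`-partial representation of the family `S`. -/
def IsPartialRep (S : J → List X → Fin p → ℝ) (N : ℕ)
    (A : X → Matrix (Fin n) (Fin n) ℝ) (B : J → Fin n → ℝ)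
    (C : Matrix (Fin p) (Fin n) ℝ) : Prop :=
  ∀ (j : J) (w : List X), w.length ≤ N → S j w = C.mulVec ((wordProd A w).mulVec (B j))

/-- `R = (ℝⁿ, {A_σ}, B, C)` is a (complete) representation of the family `S`. -/
def IsRep (S : J → List X → Fin p → ℝ)
    (A : X → Matrix (Fin n) (Fin n) ℝ) (B : J → Fin n → ℝ)
    (C : Matrix (Fin p) (Fin n) ℝ) : Prop :=
  ∀ (j : J) (w : List X), S j w = C.mulVec ((wordProd A w).mulVec (B j))

/-- Reachability: the span of the vectors `A_w B_j` is the whole state space. -/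
def IsReachable (A : X → Matrix (Fin n) (Fin n) ℝ) (B : J → Fin n → ℝ) : Prop :=
  Submodule.span ℝ
    {x : Fin n → ℝ | ∃ (w : List X) (j : J), x = (wordProd A w).mulVec (B j)} = ⊤

/-- Observability: the intersection of the kernels of the maps `C A_w` is trivial. -/
def IsObservable (A : X → Matrix (Fin n) (Fin n) ℝ)
    (C : Matrix (Fin p) (Fin n) ℝ) : Prop :=
  ∀ x : Fin n → ℝ, (∀ w : List X, C.mulVec ((wordProd A w).mulVec x) = 0) → x = 0

end PowerSeriesDefs

/-- Rank of a (possibly infinite) matrix `M : I → K → ℝ` (rows `I`, columns `K`):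
the dimension of the span of its columns. -/
noncomputable def colRank {I K : Type*} (M : I → K → ℝ) : ℕ :=
  Module.finrank ℝ (Submodule.span ℝ (Set.range fun k : K => fun i : I => M i k))

theorem wordProd_append {X : Type*} {n : ℕ} (A : X → Matrix (Fin n) (Fin n) ℝ)
    (w v : List X) : wordProd A (w ++ v) = wordProd A v * wordProd A w := by
  induction w with
  | nil => simp [wordProd]
  | cons σ w ih => simp [wordProd, ih, Matrix.mul_assoc]

theorem finrank_span_range_le_finrank_range {ι V W : Type*} [AddCommGroup V] [Module ℝ V]
    [AddCommGroup W] [Module ℝ W] [FiniteDimensional ℝ W] (c : ι → V) (L : W →ₗ[ℝ] V)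
    (hc : ∀ k, ∃ x, L x = c k) :
    Module.finrank ℝ (Submodule.span ℝ (Set.range c)) ≤ Module.finrank ℝ (LinearMap.range L) := by
  apply Submodule.finrank_mono
  rw [Submodule.span_le]
  rintro _ ⟨k, rfl⟩
  exact hc k

/-- A factor of a matrix of rank `r` through `ℝ^r` has trivial kernel. -/
theorem mulVec_injective_of_finrank_span {ι κ : Type*} {r : ℕ} (c : ι → κ → ℝ)
    (hc : Module.finrank ℝ (Submodule.span ℝ (Set.range c)) = r)
    (M : Matrix κ (Fin r) ℝ) (hM : ∀ k, ∃ x, M *ᵥ x = c k) :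
    Function.Injective M.mulVec := by
  have h := finrank_span_range_le_finrank_range c M.mulVecLin hM
  have h2 := LinearMap.finrank_range_add_finrank_ker M.mulVecLin
  rw [Module.finrank_fin_fun] at h2
  have h3 : Module.finrank ℝ (LinearMap.ker M.mulVecLin) = 0 := by omega
  exact LinearMap.ker_eq_bot.mp (Submodule.finrank_eq_zero.mp h3)

theorem IsRep.hankelRank_le {X J : Type*} {p n : ℕ} {S : J → List X → Fin p → ℝ}
    {A : X → Matrix (Fin n) (Fin n) ℝ} {B : J → Fin n → ℝ} {C : Matrix (Fin p) (Fin n) ℝ}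
    (h : IsRep S A B C) (M K : ℕ) : hankelRank S M K ≤ n := by
  let L : Matrix ({v : List X // v.length ≤ M} × Fin p) (Fin n) ℝ :=
    Matrix.of fun vi => (C * wordProd A vi.1.1) vi.2
  refine (finrank_span_range_le_finrank_range _ L.mulVecLin ?_).trans
    ((LinearMap.finrank_range_le _).trans (Module.finrank_fin_fun ℝ).le)
  rintro ⟨w, j⟩
  refine ⟨wordProd A w.1 *ᵥ B j, ?_⟩
  ext ⟨v, i⟩
  change ((C * wordProd A v.1) *ᵥ (wordProd A w.1 *ᵥ B j)) i = S j (w.1 ++ v.1) i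
  rw [h, wordProd_append]
  simp only [Matrix.mulVec_mulVec, Matrix.mul_assoc]

/-- If the truncated Hankel matrix has the same rank as the full one, the columns indexed by
short words already span the column space. -/
theorem span_hankelCol_eq_fullHankelSpan {X J : Type*} {p : ℕ} (S : J → List X → Fin p → ℝ)
    (M K r : ℕ) (hr : hankelRank S M K = r)
    (hfull : Module.rank ℝ (fullHankelSpan S) = (r : Cardinal)) :
    Submodule.span ℝ (Set.range fun wj : {w : List X // w.length ≤ K} × J =>
      hankelCol S wj.1.1 wj.2) = fullHankelSpan S := by
  have hfin : FiniteDimensional ℝ (fullHankelSpan S) :=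
    Module.rank_lt_aleph0_iff.mp (hfull ▸ Cardinal.natCast_lt_aleph0)
  have hle : Submodule.span ℝ (Set.range fun wj : {w : List X // w.length ≤ K} × J =>
      hankelCol S wj.1.1 wj.2) ≤ fullHankelSpan S := by
    apply Submodule.span_mono
    rintro _ ⟨wj, rfl⟩
    exact ⟨(wj.1.1, wj.2), rfl⟩
  have := Submodule.finiteDimensional_of_le hle
  refine Submodule.eq_of_le_of_finrank_le hle ?_
  rw [Module.finrank_eq_of_rank_eq hfull, ← hr]
  let T : (List X × Fin p → ℝ) →ₗ[ℝ] ({v : List X // v.length ≤ M} × Fin p → ℝ) :=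
    LinearMap.funLeft ℝ ℝ fun vi => (vi.1.1, vi.2)
  refine (finrank_span_range_le_finrank_range _ (T.domRestrict _) ?_).trans
    (LinearMap.finrank_range_le _)
  exact fun wj => ⟨⟨hankelCol S wj.1.1 wj.2, Submodule.subset_span ⟨wj, rfl⟩⟩, rfl⟩

/-- A factorization of the columns indexed by short words extends to all words. -/
theorem exists_factor_hankelCol {X J : Type*} {p : ℕ} (S : J → List X → Fin p → ℝ)
    (M K r : ℕ)
    (hspan : Submodule.span ℝ (Set.range fun wj : {w : List X // w.length ≤ K} × J =>
      hankelCol S wj.1.1 wj.2) = fullHankelSpan S)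
    (O : {v : List X // v.length ≤ M} × Fin p → Fin r → ℝ)
    (R : Fin r → {w : List X // w.length ≤ K} × J → ℝ)
    (hfact : ∀ (vi : {v : List X // v.length ≤ M} × Fin p)
      (wj : {w : List X // w.length ≤ K} × J),
      (∑ k : Fin r, O vi k * R k wj) = S wj.2 (wj.1.1 ++ vi.1.1) vi.2)
    (w : List X) (j : J) :
    ∃ x : Fin r → ℝ, Matrix.of O *ᵥ x = hankelColTrunc S M w j := by
  let T : (List X × Fin p → ℝ) →ₗ[ℝ] ({v : List X // v.length ≤ M} × Fin p → ℝ) :=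
    LinearMap.funLeft ℝ ℝ fun vi => (vi.1.1, vi.2)
  have hle : fullHankelSpan S ≤ (LinearMap.range (Matrix.of O).mulVecLin).comap T := by
    rw [← hspan, Submodule.span_le]
    rintro _ ⟨wj, rfl⟩
    exact ⟨fun k => R k wj, funext fun vi => hfact vi wj⟩
  exact hle (Submodule.subset_span ⟨(w, j), rfl⟩)

/-- A matrix of rank `r` with `r` rows has columns spanning `ℝ^r`. -/
theorem span_range_eq_top_of_colRank {K : Type*} {r : ℕ} (R : Fin r → K → ℝ)
    (hR : colRank R = r) : Submodule.span ℝ (Set.range fun k : K => fun i => R i k) = ⊤ :=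
  Submodule.eq_top_of_finrank_eq (hR.trans (Module.finrank_fin_fun ℝ).symm)

theorem exists_mul_eq_of_forall_mulVec {κ : Type*} {m n : Type*} [Fintype m] [Fintype n]
    [DecidableEq m]
    (P : Matrix κ n ℝ) (Q : Matrix κ m ℝ) (h : ∀ y, ∃ z, P *ᵥ z = Q *ᵥ y) :
    ∃ A : Matrix n m ℝ, P * A = Q := by
  choose f hf using fun k : m => h (Pi.single k 1)
  refine ⟨Matrix.of fun i k => f k i, ?_⟩
  ext u k
  have := congrFun (hf k) u
  rw [Matrix.mulVec_single_one] at this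
  exact this

/-- if the span of the columns of the full Hankel matrix is
finite-dimensional of dimension `r = rank H_{Ψ,N,N}`, then the factorization-based
construction applied to a rank-`r` factorization `H_{Ψ,N+1,N} = O · R` yields a
(complete) representation of `Ψ`, which is minimal. -/
theorem stmt6 {X J : Type*} [Fintype X] {p : ℕ} (S : J → List X → Fin p → ℝ)
    (N r : ℕ) (hN : 0 < N)
    (hr : hankelRank S N N = r)
    (hfull : Module.rank ℝ (fullHankelSpan S) = (r : Cardinal))
    (O : {v : List X // v.length ≤ N + 1} × Fin p → Fin r → ℝ)
    (R : Fin r → {w : List X // w.length ≤ N} × J → ℝ)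
    (hfact : ∀ (vi : {v : List X // v.length ≤ N + 1} × Fin p)
      (wj : {w : List X // w.length ≤ N} × J),
      (∑ k : Fin r, O vi k * R k wj) = S wj.2 (wj.1.1 ++ vi.1.1) vi.2)
    (hO : colRank O = r) (hR : colRank R = r) :
    letI Ctil : Matrix (Fin p) (Fin r) ℝ :=
      Matrix.of fun i k => O (⟨[], Nat.zero_le _⟩, i) k
    letI Btil : J → Fin r → ℝ := fun j k => R k (⟨[], Nat.zero_le _⟩, j)
    letI Γ : {u : List X // u.length ≤ N} × Fin p → Fin r → ℝ :=
      fun ui k => O (⟨ui.1.1, ui.1.2.trans (Nat.le_succ N)⟩, ui.2) k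
    letI Γσ : X → {u : List X // u.length ≤ N} × Fin p → Fin r → ℝ :=
      fun σ ui k => O (⟨σ :: ui.1.1, Nat.succ_le_succ ui.1.2⟩, ui.2) k
    (∀ σ : X, ∃! Atil : Matrix (Fin r) (Fin r) ℝ,
      ∀ (ui : {u : List X // u.length ≤ N} × Fin p) (k' : Fin r),
        (∑ k : Fin r, Γ ui k * Atil k k') = Γσ σ ui k') ∧
    (∀ Atil : X → Matrix (Fin r) (Fin r) ℝ,
      (∀ (σ : X) (ui : {u : List X // u.length ≤ N} × Fin p) (k' : Fin r),
        (∑ k : Fin r, Γ ui k * Atil σ k k') = Γσ σ ui k') →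
      IsRep S Atil Btil Ctil ∧
      (∀ (n : ℕ) (A' : X → Matrix (Fin n) (Fin n) ℝ) (B' : J → Fin n → ℝ)
         (C' : Matrix (Fin p) (Fin n) ℝ),
         IsRep S A' B' C' → r ≤ n)) := by
  set Ctil : Matrix (Fin p) (Fin r) ℝ :=
    Matrix.of fun i k => O (⟨[], Nat.zero_le _⟩, i) k
  set Btil : J → Fin r → ℝ := fun j k => R k (⟨[], Nat.zero_le _⟩, j)
  set Γ : {u : List X // u.length ≤ N} × Fin p → Fin r → ℝ :=
    fun ui k => O (⟨ui.1.1, ui.1.2.trans (Nat.le_succ N)⟩, ui.2) k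
  set Γσ : X → {u : List X // u.length ≤ N} × Fin p → Fin r → ℝ :=
    fun σ ui k => O (⟨σ :: ui.1.1, Nat.succ_le_succ ui.1.2⟩, ui.2) k
  have hspan := span_hankelCol_eq_fullHankelSpan S N N r hr hfull
  have hx := exists_factor_hankelCol S (N + 1) N r hspan O R hfact
  have hΓ {x w j} (h : Matrix.of O *ᵥ x = hankelColTrunc S (N + 1) w j) :
      Matrix.of Γ *ᵥ x = hankelColTrunc S N w j := by
    ext ui
    exact congrFun h (⟨ui.1.1, ui.1.2.trans (Nat.le_succ N)⟩, ui.2)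
  have hΓσ {x w j} (σ : X) (h : Matrix.of O *ᵥ x = hankelColTrunc S (N + 1) w j) :
      Matrix.of (Γσ σ) *ᵥ x = hankelColTrunc S N (w ++ [σ]) j := by
    ext ui
    refine (congrFun h (⟨σ :: ui.1.1, Nat.succ_le_succ ui.1.2⟩, ui.2)).trans ?_
    simp [hankelColTrunc]
  have hinj : Function.Injective (Matrix.of Γ).mulVec :=
    mulVec_injective_of_finrank_span _ hr _ fun wj => (hx wj.1.1 wj.2).imp fun _ => hΓ
  have hmul (σ : X) (A : Matrix (Fin r) (Fin r) ℝ) :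
      (∀ ui k', (∑ k : Fin r, Γ ui k * A k k') = Γσ σ ui k') ↔
        Matrix.of Γ * A = Matrix.of (Γσ σ) :=
    ⟨fun h => Matrix.ext h, fun h ui k' => congrFun (congrFun h ui) k'⟩
  refine ⟨fun σ => ?_, fun A hA => ⟨?_, fun n A' B' C' h => hr ▸ h.hankelRank_le N N⟩⟩
  · obtain ⟨A, hA⟩ : ∃ A : Matrix (Fin r) (Fin r) ℝ,
        Matrix.of Γ * A = Matrix.of (Γσ σ) := by
      refine exists_mul_eq_of_forall_mulVec _ _ ?_
      have hle : (⊤ : Submodule ℝ (Fin r → ℝ)) ≤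
          (LinearMap.range (Matrix.of Γ).mulVecLin).comap (Matrix.of (Γσ σ)).mulVecLin := by
        rw [← span_range_eq_top_of_colRank R hR, Submodule.span_le]
        rintro _ ⟨wj, rfl⟩
        obtain ⟨x, h⟩ := hx (wj.1.1 ++ [σ]) wj.2
        refine ⟨x, (hΓ h).trans (hΓσ σ ?_).symm⟩
        exact funext fun vi => hfact vi wj
      exact fun y => hle (Submodule.mem_top (x := y))
    refine ⟨A, (hmul σ A).2 hA, fun A' hA' => ?_⟩
    have hA' := ((hmul σ A').1 hA').trans hA.symm
    refine Matrix.ext_of_mulVec_single fun k => hinj ?_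
    simp only [Matrix.mulVec_mulVec, hA']
  · have hstate (j : J) (w : List X) :
        Matrix.of O *ᵥ (wordProd A w *ᵥ Btil j) = hankelColTrunc S (N + 1) w j := by
      induction w using List.reverseRecOn with
      | nil =>
        rw [wordProd, Matrix.one_mulVec]
        exact funext fun vi => hfact vi (⟨[], Nat.zero_le _⟩, j)
      | append_singleton w σ ih =>
        obtain ⟨x, h⟩ := hx (w ++ [σ]) j
        have hxA : x = wordProd A (w ++ [σ]) *ᵥ Btil j := hinj <| by
          rw [hΓ h, ← hΓσ σ ih, ← (hmul σ _).1 (hA σ), wordProd_append]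
          simp [wordProd, Matrix.mul_assoc]
        rw [← hxA, h]
    intro j w
    ext i
    refine Eq.trans ?_ (congrFun (hstate j w) (⟨[], Nat.zero_le _⟩, i)).symm
    simp [hankelColTrunc]
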